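/- arXiv:2108.13506 — 4 statements merged into one kernel-verified Lean document; each statement's English description precedes it below -/
import Mathlib

section
/- Fix an integer n ≥ 2 and define λ(c) = (1 - n·c + (n-1)·c^{n/(n-1)})/n for c ∈ [0,1]. Then the map c ↦ (1-c)/λ(c) is strictly increasing on [0,1). In particular, for any x₀ > 0 the upper support bound x̄(c) = (1-c)·x₀/λ(c) of the driftless equilibrium distribution is strictly increasing in the submission fee c. -/
/-- The slope coefficient `λ(c) = (1 - n·c + (n-1)·c^{n/(n-1)})/n` of the equilibrium
winning probability in the `n`-player risk-taking contest with submission fee `c`. -/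
noncomputable def lamFee (n : ℕ) (c : ℝ) : ℝ :=
  (1 - n * c + ((n : ℝ) - 1) * c ^ ((n : ℝ) / ((n : ℝ) - 1))) / n

theorem one_lt_div_sub_one {n : ℕ} (hn : 2 ≤ n) : 1 < (n : ℝ) / ((n : ℝ) - 1) := by
  have h : (2 : ℝ) ≤ n := by exact_mod_cast hn
  rw [one_lt_div (by linarith)]
  linarith

theorem lamFee_pos {n : ℕ} (hn : 2 ≤ n) {c : ℝ} (hc : c ∈ Set.Ico (0 : ℝ) 1) :
    0 < lamFee n c := by
  have h : (2 : ℝ) ≤ n := by exact_mod_cast hn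
  have hn1 : (0 : ℝ) < n - 1 := by linarith
  have hb := one_add_mul_self_lt_rpow_one_add (s := c - 1) (by linarith [hc.1])
    (by linarith [hc.2]) (one_lt_div_sub_one hn)
  rw [add_sub_cancel] at hb
  have hm := mul_lt_mul_of_pos_left hb hn1
  have he : ((n : ℝ) - 1) * (1 + n / (n - 1) * (c - 1)) = n * c - 1 := by
    field_simp
    ring
  exact div_pos (by linarith) (by linarith)

/-- Strict convexity of `c ↦ c ^ p`, cross-multiplied for the secants through `1`. -/
theorem one_sub_mul_rpow_lt {p c d : ℝ} (hp : 1 < p) (hc : 0 ≤ c) (hcd : c < d) (hd : d < 1) :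
    (1 - c) * d ^ p < (1 - d) * c ^ p + (d - c) := by
  have hc1 : 0 < 1 - c := by linarith
  have h := (strictConvexOn_rpow hp).2 (Set.mem_Ici.2 hc) (Set.mem_Ici.2 zero_le_one)
    (by linarith) (div_pos (sub_pos.2 hd) hc1) (div_pos (sub_pos.2 hcd) hc1)
    (by field_simp; ring)
  simp only [smul_eq_mul, Real.one_rpow, mul_one] at h
  rw [show (1 - d) / (1 - c) * c + (d - c) / (1 - c) = d by field_simp; ring] at h
  have hm := mul_lt_mul_of_pos_left h hc1
  rwa [show (1 - c) * ((1 - d) / (1 - c) * c ^ p + (d - c) / (1 - c)) =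
    (1 - d) * c ^ p + (d - c) by field_simp] at hm

theorem strictMonoOn_one_sub_div_lamFee {n : ℕ} (hn : 2 ≤ n) :
    StrictMonoOn (fun c : ℝ => (1 - c) / lamFee n c) (Set.Ico (0 : ℝ) 1) := by
  intro c hc d hd hcd
  have h : (2 : ℝ) ≤ n := by exact_mod_cast hn
  have hn0 : (0 : ℝ) < n := by linarith
  have hm := mul_lt_mul_of_pos_left
    (one_sub_mul_rpow_lt (one_lt_div_sub_one hn) hc.1 hcd hd.2) (by linarith : (0 : ℝ) < n - 1)
  refine (div_lt_div_iff₀ (lamFee_pos hn hc) (lamFee_pos hn hd)).2 ?_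
  unfold lamFee
  rw [← mul_div_assoc, ← mul_div_assoc, div_lt_div_iff_of_pos_right hn0]
  linarith

theorem upper_support_strictMono (n : ℕ) (hn : 2 ≤ n) :
    StrictMonoOn (fun c : ℝ => (1 - c) / lamFee n c) (Set.Ico (0 : ℝ) 1) ∧
    ∀ x₀ : ℝ, 0 < x₀ →
      StrictMonoOn (fun c : ℝ => (1 - c) * x₀ / lamFee n c) (Set.Ico (0 : ℝ) 1) := by
  refine ⟨strictMonoOn_one_sub_div_lamFee hn, fun x₀ hx₀ c hc d hd hcd => ?_⟩
  simpa only [mul_div_right_comm] using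
    mul_lt_mul_of_pos_right (strictMonoOn_one_sub_div_lamFee hn hc hd hcd) hx₀
end

section
/- Fix an integer n ≥ 2, x₀ > 0 and c ∈ [0,1). Let λ(c) = (1 - n·c + (n-1)·c^{n/(n-1)})/n, x̄(c) = (1-c)·x₀/λ(c), and let F̃_c be the driftless equilibrium cdf: F̃_c(x) = (c + λ(c)·x/x₀)^{1/(n-1)} for x ∈ [0, x̄(c)], F̃_c(x) = 1 for x ≥ x̄(c), and F̃_c(x) = 0 for x < 0. Then ∫₀^{x̄(c)} (1 - F̃_c(x)) dx = x₀; that is, the probability distribution with cdf F̃_c has mean exactly x₀, so F̃_c is feasible for the Skorokhod-embedding constraint of a driftless Brownian motion started at x₀ and absorbed at 0. -/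
/-- Upper bound of the support of the driftless equilibrium distribution:
`x̄(c) = (1-c)·x₀/λ(c)`. -/
noncomputable def tildeXbar (n : ℕ) (x₀ c : ℝ) : ℝ :=
  (1 - c) * x₀ / lamFee n c

/-- The driftless equilibrium cdf: `F̃_c(x) = (c + λ(c)·x/x₀)^{1/(n-1)}` on `[0, x̄(c)]`,
equal to `1` above `x̄(c)` and `0` below `0`. -/
noncomputable def tildeF (n : ℕ) (x₀ c x : ℝ) : ℝ :=
  if x < 0 then 0
  else if x ≤ tildeXbar n x₀ c then (c + lamFee n c * x / x₀) ^ ((1 : ℝ) / ((n : ℝ) - 1))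
  else 1

/-- The driftless equilibrium distribution has mean exactly `x₀`, hence it is feasible
for the Skorokhod-embedding constraint of a driftless Brownian motion started at `x₀`
and absorbed at `0`. -/
theorem tildeF_mean_eq (n : ℕ) (hn : 2 ≤ n) (x₀ c : ℝ) (hx₀ : 0 < x₀)
    (hc : c ∈ Set.Ico (0 : ℝ) 1) :
    ∫ x in (0 : ℝ)..(tildeXbar n x₀ c), (1 - tildeF n x₀ c x) = x₀ := by
  have hn' : (2 : ℝ) ≤ n := by exact_mod_cast hn
  have hm : 0 < (n : ℝ) - 1 := by linarith
  have hl : 0 < lamFee n c := lamFee_pos hn hc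
  have hX : 0 ≤ tildeXbar n x₀ c :=
    div_nonneg (mul_nonneg (by linarith [hc.2]) hx₀.le) hl.le
  have hq : 0 < (1 : ℝ) / ((n : ℝ) - 1) := by positivity
  have ha : lamFee n c / x₀ ≠ 0 := by positivity
  have hcongr : ∫ x in (0 : ℝ)..(tildeXbar n x₀ c), (1 - tildeF n x₀ c x) =
      ∫ x in (0 : ℝ)..(tildeXbar n x₀ c),
        (1 - (c + lamFee n c / x₀ * x) ^ ((1 : ℝ) / ((n : ℝ) - 1))) := by
    refine intervalIntegral.integral_congr fun x hx ↦ ?_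
    rw [Set.uIcc_of_le hX] at hx
    simp only [tildeF, if_neg hx.1.not_gt, if_pos hx.2, mul_div_right_comm]
  have hcont : Continuous fun x : ℝ ↦
      (c + lamFee n c / x₀ * x) ^ ((1 : ℝ) / ((n : ℝ) - 1)) :=
    (by fun_prop : Continuous fun x : ℝ ↦ c + lamFee n c / x₀ * x).rpow_const
      fun _ ↦ Or.inr hq.le
  have hend : c + lamFee n c / x₀ * tildeXbar n x₀ c = 1 := by
    unfold tildeXbar
    field_simp
    ring
  have hexp : (1 : ℝ) / ((n : ℝ) - 1) + 1 = (n : ℝ) / ((n : ℝ) - 1) := by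
    field_simp
    ring
  rw [hcongr, intervalIntegral.integral_sub intervalIntegrable_const
      (hcont.intervalIntegrable _ _), intervalIntegral.integral_const,
    intervalIntegral.integral_comp_add_mul (fun u : ℝ ↦ u ^ ((1 : ℝ) / ((n : ℝ) - 1))) ha,
    hend, integral_rpow (Or.inl (by linarith)), hexp, Real.one_rpow, mul_zero, add_zero]
  have hlam : (n : ℝ) * lamFee n c =
      1 - n * c + ((n : ℝ) - 1) * c ^ ((n : ℝ) / ((n : ℝ) - 1)) := by
    unfold lamFee
    field_simp
  simp only [smul_eq_mul, tildeXbar, sub_zero, mul_one]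
  generalize c ^ ((n : ℝ) / ((n : ℝ) - 1)) = y at hlam ⊢
  field_simp
  linarith
end

section
/- Let M > 0 and let s : [0,M] → ℝ be differentiable with s'(x) > 0 for all x ∈ (0,M). Let F, F̂ : ℝ → [0,1] be cdfs of probability distributions supported in [0,M] (so F(x) = F̂(x) = 0 for x < 0 and F(M) = F̂(M) = 1) satisfying the equal-scale-moment condition ∫₀^M s'(x)·(F̂(x) - F(x)) dx = 0, and suppose there exists x* ∈ (0,M) such that F(x) ≥ F̂(x) for all x ≤ x* and F(x) ≤ F̂(x) for all x ≥ x*. Let φ : [0,M] → ℝ be nondecreasing and absolutely continuous. If φ'/s' is nondecreasing on (0,M), then ∫₀^M φ'(x)·(F̂(x) - F(x)) dx ≥ 0; equivalently, the expectation of φ under F̂ is at most the expectation of φ under F. If instead φ'/s' is nonincreasing on (0,M), the reverse inequality holds. -/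
open MeasureTheory in
/-- A function with a derivative that is nonnegative inside an interval has an
interval integrable derivative. -/
theorem intervalIntegrable_of_hasDerivAt_of_nonneg {a b : ℝ} (hab : a ≤ b) {s s' : ℝ → ℝ}
    (hs : ∀ x ∈ Set.Icc a b, HasDerivAt s (s' x) x) (hs' : ∀ x ∈ Set.Ioo a b, 0 ≤ s' x) :
    IntervalIntegrable s' volume a b :=
  (intervalIntegrable_iff_integrableOn_Ioc_of_le hab).2 <|
    intervalIntegral.integrableOn_deriv_of_nonneg
      (fun x hx => (hs x hx).continuousAt.continuousWithinAt)
      (fun x hx => hs x (Set.Ioo_subset_Icc_self hx)) hs'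

open MeasureTheory in
/-- Multiplying by a difference of monotone functions preserves interval integrability. -/
theorem IntervalIntegrable.mul_monotone_sub {a b : ℝ} {f g h : ℝ → ℝ}
    (hf : IntervalIntegrable f volume a b) (hg : Monotone g) (hh : Monotone h) :
    IntervalIntegrable (fun x => f x * (g x - h x)) volume a b := by
  rw [intervalIntegrable_iff] at hf ⊢
  refine Integrable.mul_bdd
    (c := (g (max a b) - g (min a b)) + (h (max a b) - h (min a b)) + |g (min a b) - h (min a b)|)
    hf (hg.measurable.sub hh.measurable).aestronglyMeasurable ?_
  filter_upwards [ae_restrict_mem measurableSet_uIoc] with x hx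
  have hg₁ := hg hx.1.le
  have hg₂ := hg hx.2
  have hh₁ := hh hx.1.le
  have hh₂ := hh hx.2
  rw [Real.norm_eq_abs, abs_le]
  constructor <;>
    linarith [neg_abs_le (g (min a b) - h (min a b)), le_abs_self (g (min a b) - h (min a b))]

/-- The comparison engine behind Theorem 2 of the paper (after Theorem 3.2 of
Nutz–Zhang): if cdfs `F, F̂` supported in `[0,M]` have equal `s`-moments and cross once
(`F ≥ F̂` before `x*`, `F ≤ F̂` after), and `φ` is nondecreasing and absolutely
continuous (with density `φ'`), then `E_F[φ] ≥ E_{F̂}[φ]` when `φ'/s'` is nondecreasing,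
and `E_F[φ] ≤ E_{F̂}[φ]` when `φ'/s'` is nonincreasing; equivalently in terms of
`∫₀^M φ'·(F̂ - F)`. -/
theorem single_crossing_comparison (M : ℝ) (hM : 0 < M)
    (s s' : ℝ → ℝ)
    (hs : ∀ x ∈ Set.Icc (0 : ℝ) M, HasDerivAt s (s' x) x)
    (hs'pos : ∀ x ∈ Set.Ioo (0 : ℝ) M, 0 < s' x)
    (F Fhat : ℝ → ℝ)
    (hFmono : Monotone F) (hFhatmono : Monotone Fhat)
    (hF0 : ∀ x : ℝ, x < 0 → F x = 0) (hFhat0 : ∀ x : ℝ, x < 0 → Fhat x = 0)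
    (hFM : F M = 1) (hFhatM : Fhat M = 1)
    (hmoment : (∫ x in (0 : ℝ)..M, s' x * (Fhat x - F x)) = 0)
    (xstar : ℝ) (hxstar : xstar ∈ Set.Ioo (0 : ℝ) M)
    (hcross₁ : ∀ x : ℝ, x ≤ xstar → Fhat x ≤ F x)
    (hcross₂ : ∀ x : ℝ, xstar ≤ x → F x ≤ Fhat x)
    (φ φ' : ℝ → ℝ)
    (hφAC : ∀ x ∈ Set.Icc (0 : ℝ) M, φ x = φ 0 + ∫ t in (0 : ℝ)..x, φ' t)
    (hφ'int : IntervalIntegrable φ' MeasureTheory.volume 0 M)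
    (hφ'nonneg : ∀ x ∈ Set.Icc (0 : ℝ) M, 0 ≤ φ' x) :
    (MonotoneOn (fun x => φ' x / s' x) (Set.Ioo (0 : ℝ) M) →
      0 ≤ ∫ x in (0 : ℝ)..M, φ' x * (Fhat x - F x)) ∧
    (AntitoneOn (fun x => φ' x / s' x) (Set.Ioo (0 : ℝ) M) →
      (∫ x in (0 : ℝ)..M, φ' x * (Fhat x - F x)) ≤ 0) := by
  have hs'int : IntervalIntegrable s' MeasureTheory.volume 0 M :=
    intervalIntegrable_of_hasDerivAt_of_nonneg hM.le hs fun x hx => (hs'pos x hx).le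
  have hsD := (hs'int.mul_monotone_sub hFhatmono hFmono).const_mul (φ' xstar / s' xstar)
  have hφD := hφ'int.mul_monotone_sub hFhatmono hFmono
  have hconst : ∫ x in (0 : ℝ)..M, φ' xstar / s' xstar * (s' x * (Fhat x - F x)) = 0 := by
    rw [intervalIntegral.integral_const_mul, hmoment, mul_zero]
  have hfactor : ∀ x ∈ Set.Ioo (0 : ℝ) M,
      φ' x * (Fhat x - F x) - φ' xstar / s' xstar * (s' x * (Fhat x - F x)) =
        s' x * ((φ' x / s' x - φ' xstar / s' xstar) * (Fhat x - F x)) := by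
    intro x hx
    have hne := (hs'pos x hx).ne'
    linear_combination (-(Fhat x - F x)) * mul_div_cancel₀ (φ' x) hne
  constructor
  · intro hmono
    refine hconst.ge.trans <|
      intervalIntegral.integral_mono_on_of_le_Ioo hM.le hsD hφD fun x hx => ?_
    rw [← sub_nonneg, hfactor x hx]
    refine mul_nonneg (hs'pos x hx).le ?_
    rcases le_total x xstar with h | h
    · exact mul_nonneg_of_nonpos_of_nonpos (sub_nonpos.2 (hmono hx hxstar h))
        (sub_nonpos.2 (hcross₁ x h))
    · exact mul_nonneg (sub_nonneg.2 (hmono hxstar hx h)) (sub_nonneg.2 (hcross₂ x h))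
  · intro hanti
    refine le_trans
      (intervalIntegral.integral_mono_on_of_le_Ioo hM.le hφD hsD fun x hx => ?_) hconst.le
    rw [← sub_nonpos, hfactor x hx]
    refine mul_nonpos_of_nonneg_of_nonpos (hs'pos x hx).le ?_
    rcases le_total x xstar with h | h
    · exact mul_nonpos_of_nonneg_of_nonpos (sub_nonneg.2 (hanti hx hxstar h))
        (sub_nonpos.2 (hcross₁ x h))
    · exact mul_nonpos_of_nonpos_of_nonneg (sub_nonpos.2 (hanti hxstar hx h))
        (sub_nonneg.2 (hcross₂ x h))
end

section
/- Fix an integer n ≥ 2, x₀ > 0, σ > 0 and μ < 0, and let s_B(x) = (σ²/(2μ))·(1 - exp(-2μx/σ²)). Let λ(·) = (1 - n·(·) + (n-1)·(·)^{n/(n-1)})/n, and for c ∈ [0,1) let F_c be the equilibrium cdf F_c(x) = (c + λ(c)·s_B(x)/s_B(x₀))^{1/(n-1)} on [0, x̄(c)], x̄(c) = -(σ²/(2μ))·log(1 - (2μ/σ²)·(1-c)·s_B(x₀)/λ(c)), F_c = 1 above x̄(c). Define M(c) = ∫₀^∞ (1 - F_c(x)ⁿ) dx, the expected maximum of n i.i.d.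 draws from F_c. Then there exists c ∈ (0,1) with M(c) > M(0): even with negative drift, some strictly positive submission fee yields a strictly higher expected winner's performance than no fee. -/
open MeasureTheory

/-- Scale function of Brownian motion with drift `μ` and volatility `σ`:
`s_B(x) = (σ²/(2μ))·(1 - exp(-2μx/σ²))`. -/
noncomputable def sB (μ σ x : ℝ) : ℝ :=
  (σ ^ 2 / (2 * μ)) * (1 - Real.exp (-(2 * μ * x) / σ ^ 2))

/-- Upper bound of the support of the equilibrium distribution for Brownian motion with
drift: `x̄(c) = -(σ²/(2μ))·log(1 - (2μ/σ²)·(1-c)·s_B(x₀)/λ(c))`. -/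
noncomputable def driftXbar (n : ℕ) (x₀ μ σ c : ℝ) : ℝ :=
  -(σ ^ 2 / (2 * μ)) * Real.log (1 - (2 * μ / σ ^ 2) * ((1 - c) * sB μ σ x₀ / lamFee n c))

/-- Equilibrium cdf for Brownian motion with drift:
`F_c(x) = (c + λ(c)·s_B(x)/s_B(x₀))^{1/(n-1)}` on `[0, x̄(c)]`, `1` above, `0` below `0`. -/
noncomputable def driftF (n : ℕ) (x₀ μ σ c x : ℝ) : ℝ :=
  if x < 0 then 0
  else if x ≤ driftXbar n x₀ μ σ c then
    (c + lamFee n c * sB μ σ x / sB μ σ x₀) ^ ((1 : ℝ) / ((n : ℝ) - 1))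
  else 1

/-- Expected maximum of `n` i.i.d. draws from the equilibrium distribution:
`M(c) = ∫₀^∞ (1 - F_c(x)ⁿ) dx`. -/
noncomputable def driftExpMax (n : ℕ) (x₀ μ σ c : ℝ) : ℝ :=
  ∫ x in Set.Ioi (0 : ℝ), (1 - (driftF n x₀ μ σ c x) ^ n)

/-- For `c = a ^ m`, the slope coefficient of the `(m+1)`-player contest is a polynomial in `a`. -/
lemma lamFee_pow (m : ℕ) (hm : 1 ≤ m) (a : ℝ) (ha : 0 ≤ a) :
    lamFee (m + 1) (a ^ m) = (1 - a ^ m * ((m + 1) - m * a)) / (m + 1) := by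
  have hm0 : (m : ℝ) ≠ 0 := by positivity
  have h : (a ^ m) ^ (((m + 1 : ℕ) : ℝ) / (((m + 1 : ℕ) : ℝ) - 1)) = a ^ (m + 1) := by
    rw [← Real.rpow_natCast a m, ← Real.rpow_mul ha, ← Real.rpow_natCast]
    congr 1
    push_cast
    rw [add_sub_cancel_right, mul_div_cancel₀ _ hm0]
  rw [lamFee, h]
  push_cast
  ring

lemma sB_eq (μ σ x : ℝ) (hμ : μ < 0) (hσ : 0 < σ) :
    sB μ σ x = (Real.exp (-(2 * μ) / σ ^ 2 * x) - 1) / (-(2 * μ) / σ ^ 2) := by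
  have hσ' := hσ.ne'
  have hμ' := hμ.ne
  rw [sB, show -(2 * μ * x) / σ ^ 2 = -(2 * μ) / σ ^ 2 * x by ring]
  field_simp
  ring

/-- The inverse scale transform `y ↦ log (1 + b * y) / β`, applied to the affine function of
`p ^ m` and integrated against the law of the maximum, equals the integral of the tail. -/
lemma integral_one_sub_cdf_pow (m : ℕ) (hm : 1 ≤ m) (a b β l : ℝ) (ha : 0 ≤ a) (ha1 : a < 1)
    (hb : 0 < b) (hβ : 0 < β) (hl : 0 < l) :
    ∫ x in (0 : ℝ)..(Real.log (1 + b * ((1 - a ^ m) / l)) / β),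
        (1 - ((a ^ m + l * ((Real.exp (β * x) - 1) / b)) ^ ((1 : ℝ) / m)) ^ (m + 1)) =
      ∫ p in a..1, (m + 1) * p ^ m * (Real.log (1 + b * ((p ^ m - a ^ m) / l)) / β) := by
  set f : ℝ → ℝ := fun p => Real.log (1 + b * ((p ^ m - a ^ m) / l)) / β with hf
  set f' : ℝ → ℝ := fun p =>
    (b * ((m * p ^ (m - 1)) / l)) / (1 + b * ((p ^ m - a ^ m) / l)) / β with hf'
  set g : ℝ → ℝ := fun x =>
    1 - ((a ^ m + l * ((Real.exp (β * x) - 1) / b)) ^ ((1 : ℝ) / m)) ^ (m + 1) with hg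
  have hpos : ∀ p ∈ Set.uIcc a 1, 0 < 1 + b * ((p ^ m - a ^ m) / l) := by
    intro p hp
    rw [Set.uIcc_of_le ha1.le] at hp
    have : a ^ m ≤ p ^ m := pow_le_pow_left₀ ha hp.1 m
    have : 0 ≤ (p ^ m - a ^ m) / l := div_nonneg (by linarith) hl.le
    positivity
  have hder : ∀ p ∈ Set.uIcc a 1, HasDerivAt f (f' p) p := by
    intro p hp
    have h1 : HasDerivAt (fun p : ℝ => 1 + b * ((p ^ m - a ^ m) / l))
        (b * ((m * p ^ (m - 1)) / l)) p :=
      ((((hasDerivAt_pow m p).sub_const (a ^ m)).div_const l).const_mul b).const_add 1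
    exact (h1.log (hpos p hp).ne').div_const β
  have hf'c : ContinuousOn f' (Set.uIcc a 1) := by
    refine ContinuousOn.div_const (ContinuousOn.div (by fun_prop) (by fun_prop) ?_) β
    exact fun p hp => (hpos p hp).ne'
  have hgc : Continuous g := by
    have : Continuous fun x : ℝ =>
        (a ^ m + l * ((Real.exp (β * x) - 1) / b)) ^ ((1 : ℝ) / m) :=
      (by fun_prop : Continuous fun x : ℝ => a ^ m + l * ((Real.exp (β * x) - 1) / b)).rpow_const
        fun x => Or.inr (by positivity)
    exact continuous_const.sub (this.pow _)
  have hgf : ∀ p ∈ Set.uIcc a 1, g (f p) = 1 - p ^ (m + 1) := by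
    intro p hp
    have hp0 : 0 ≤ p := by
      rw [Set.uIcc_of_le ha1.le] at hp
      exact ha.trans hp.1
    have h1 : a ^ m + l * ((Real.exp (β * f p) - 1) / b) = p ^ m := by
      rw [hf]
      simp only
      rw [mul_div_cancel₀ _ hβ.ne', Real.exp_log (hpos p hp)]
      field_simp
      ring
    simp only [hg]
    rw [h1, one_div, Real.pow_rpow_inv_natCast hp0 (by omega)]
  have hfa : f a = 0 := by simp [hf]
  have hf1 : f 1 = Real.log (1 + b * ((1 - a ^ m) / l)) / β := by simp [hf]
  have hsub := intervalIntegral.integral_comp_mul_deriv hder hf'c hgc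
  rw [hfa, hf1] at hsub
  rw [← hsub]
  have hparts := intervalIntegral.integral_mul_deriv_eq_deriv_mul (a := a) (b := 1)
    (u := fun p => 1 - p ^ (m + 1)) (u' := fun p => -((m + 1 : ℕ) * p ^ m)) (v := f) (v' := f')
    (fun p _ => by simpa using (hasDerivAt_pow (m + 1) p).const_sub 1) hder
    (Continuous.intervalIntegrable (by fun_prop) _ _) hf'c.intervalIntegrable
  rw [hfa] at hparts
  calc _ = ∫ p in a..1, (1 - p ^ (m + 1)) * f' p := by
        refine intervalIntegral.integral_congr fun p hp => ?_
        simp only [Function.comp, hgf p hp]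
    _ = _ := by
        rw [hparts]
        simp only [one_pow, sub_self, zero_mul, mul_zero, zero_sub, neg_mul,
          intervalIntegral.integral_neg, neg_neg]
        push_cast
        rfl

/-- The expected maximum in quantile coordinates. -/
lemma driftExpMax_eq (m : ℕ) (hm : 1 ≤ m) (x₀ σ μ a : ℝ) (hx₀ : 0 < x₀) (hσ : 0 < σ) (hμ : μ < 0)
    (ha : 0 ≤ a) (ha1 : a < 1) (hl : 0 < lamFee (m + 1) (a ^ m)) :
    driftExpMax (m + 1) x₀ μ σ (a ^ m) =
      ∫ p in (0 : ℝ)..1, (m + 1) * p ^ m *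
        (Real.log (1 + (Real.exp (-(2 * μ) / σ ^ 2 * x₀) - 1) *
          (max (p ^ m - a ^ m) 0 / lamFee (m + 1) (a ^ m))) / (-(2 * μ) / σ ^ 2)) := by
  have hβ : 0 < -(2 * μ) / σ ^ 2 := div_pos (by linarith) (by positivity)
  have hs := sB_eq μ σ (hμ := hμ) (hσ := hσ)
  have hβ2 : 2 * μ / σ ^ 2 = -(-(2 * μ) / σ ^ 2) := by ring
  have hβ3 : σ ^ 2 / (2 * μ) = -(1 / (-(2 * μ) / σ ^ 2)) := by
    have := hσ.ne'
    have := hμ.ne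
    field_simp
  set β := -(2 * μ) / σ ^ 2
  have hb : 0 < Real.exp (β * x₀) - 1 := by
    have := Real.add_one_lt_exp (mul_pos hβ hx₀).ne'
    nlinarith [mul_pos hβ hx₀]
  set b := Real.exp (β * x₀) - 1 with hbdef
  set l := lamFee (m + 1) (a ^ m) with hldef
  have ham : a ^ m < 1 := pow_lt_one₀ ha ha1 (by omega)
  have hX : driftXbar (m + 1) x₀ μ σ (a ^ m) = Real.log (1 + b * ((1 - a ^ m) / l)) / β := by
    rw [driftXbar, hβ2, hβ3, hs, ← hldef, ← hbdef]
    rw [show 1 - -β * ((1 - a ^ m) * (b / β) / l) = 1 + b * ((1 - a ^ m) / l) by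
      field_simp
      ring]
    ring
  have hX0 : 0 ≤ Real.log (1 + b * ((1 - a ^ m) / l)) / β := by
    refine div_nonneg (Real.log_nonneg ?_) hβ.le
    have : 0 ≤ b * ((1 - a ^ m) / l) := mul_nonneg hb.le (div_nonneg (by linarith) hl.le)
    linarith
  have hF : ∀ x, 0 < x → x ≤ Real.log (1 + b * ((1 - a ^ m) / l)) / β →
      driftF (m + 1) x₀ μ σ (a ^ m) x =
        (a ^ m + l * ((Real.exp (β * x) - 1) / b)) ^ ((1 : ℝ) / m) := by
    intro x hx hx1
    rw [driftF, if_neg hx.not_gt, hX, if_pos hx1, hs, hs, ← hldef, ← hbdef]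
    congr 1
    · field_simp
    · push_cast
      ring
  have htail : driftExpMax (m + 1) x₀ μ σ (a ^ m) =
      ∫ x in (0 : ℝ)..(Real.log (1 + b * ((1 - a ^ m) / l)) / β),
        (1 - ((a ^ m + l * ((Real.exp (β * x) - 1) / b)) ^ ((1 : ℝ) / m)) ^ (m + 1)) := by
    rw [driftExpMax, intervalIntegral.integral_of_le hX0,
      setIntegral_eq_of_subset_of_forall_sdiff_eq_zero measurableSet_Ioi
        (Set.Ioc_subset_Ioi_self (a := Real.log (1 + b * ((1 - a ^ m) / l)) / β) (b := (0 : ℝ)))]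
    · refine setIntegral_congr_fun measurableSet_Ioc fun x hx => ?_
      simp only [hF x hx.1 hx.2]
    · rintro x ⟨hx, hx1⟩
      have hx' : ¬ x ≤ Real.log (1 + b * ((1 - a ^ m) / l)) / β := fun h => hx1 ⟨hx, h⟩
      rw [driftF, if_neg (not_lt.2 (le_of_lt hx)), hX, if_neg hx']
      simp
  rw [htail, integral_one_sub_cdf_pow m hm a b β l ha ha1 hb hβ hl]
  have hcont : Continuous fun p : ℝ => (m + 1) * p ^ m *
      (Real.log (1 + b * (max (p ^ m - a ^ m) 0 / l)) / β) := by
    refine Continuous.mul (by fun_prop) (Continuous.div_const (Continuous.log ?_ ?_) β)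
    · fun_prop
    · intro p
      have : 0 ≤ max (p ^ m - a ^ m) 0 / l := div_nonneg (le_max_right _ _) hl.le
      positivity
  rw [← intervalIntegral.integral_add_adjacent_intervals (hcont.intervalIntegrable 0 a)
    (hcont.intervalIntegrable a 1)]
  have h0 : ∫ p in (0 : ℝ)..a, (m + 1) * p ^ m *
      (Real.log (1 + b * (max (p ^ m - a ^ m) 0 / l)) / β) = 0 := by
    refine (intervalIntegral.integral_congr (g := fun _ => (0 : ℝ)) fun p hp => ?_).trans
      intervalIntegral.integral_zero
    rw [Set.uIcc_of_le ha] at hp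
    have : p ^ m ≤ a ^ m := pow_le_pow_left₀ hp.1 hp.2 m
    simp [max_eq_right (sub_nonpos.2 this)]
  rw [h0, zero_add]
  refine intervalIntegral.integral_congr fun p hp => ?_
  rw [Set.uIcc_of_le ha1.le] at hp
  have : a ^ m ≤ p ^ m := pow_le_pow_left₀ ha hp.1 m
  simp only [max_eq_left (sub_nonneg.2 this)]

/-- The scale-transformed quantile function has mean one. -/
lemma integral_max_pow_sub_div (m : ℕ) (a l : ℝ) (ha : 0 ≤ a) (ha1 : a < 1)
    (hl : l ≠ 0) (hl' : l = (1 - a ^ m * ((m + 1) - m * a)) / (m + 1)) :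
    ∫ p in (0 : ℝ)..1, max (p ^ m - a ^ m) 0 / l = 1 := by
  have hcont : Continuous fun p : ℝ => max (p ^ m - a ^ m) 0 := by fun_prop
  have h0 : ∫ p in (0 : ℝ)..a, max (p ^ m - a ^ m) 0 = 0 := by
    refine (intervalIntegral.integral_congr (g := fun _ => (0 : ℝ)) fun p hp => ?_).trans
      intervalIntegral.integral_zero
    rw [Set.uIcc_of_le ha] at hp
    exact max_eq_right (sub_nonpos.2 (pow_le_pow_left₀ hp.1 hp.2 m))
  have h1 : ∫ p in a..1, max (p ^ m - a ^ m) 0 = ∫ p in a..1, (p ^ m - a ^ m) := by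
    refine intervalIntegral.integral_congr fun p hp => ?_
    rw [Set.uIcc_of_le ha1.le] at hp
    exact max_eq_left (sub_nonneg.2 (pow_le_pow_left₀ ha hp.1 m))
  rw [intervalIntegral.integral_div, div_eq_one_iff_eq hl,
    ← intervalIntegral.integral_add_adjacent_intervals (hcont.intervalIntegrable 0 a)
      (hcont.intervalIntegrable a 1), h0, h1, intervalIntegral.integral_sub
      (Continuous.intervalIntegrable (by fun_prop) _ _)
      (Continuous.intervalIntegrable (by fun_prop) _ _), integral_pow, hl']
  simp only [intervalIntegral.integral_const, smul_eq_mul]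
  have : (m : ℝ) + 1 ≠ 0 := by positivity
  field_simp
  ring

/-- Strict tangent-line bound for `y ↦ log (1 + b * y)`. -/
lemma lt_log_one_add_sub_log_one_add (b y z : ℝ) (hb : 0 < b) (hy : 0 ≤ y) (hz : 0 ≤ z)
    (hyz : y ≠ z) :
    b * (z - y) / (1 + b * z) < Real.log (1 + b * z) - Real.log (1 + b * y) := by
  have hz' : 0 < 1 + b * z := by positivity
  have hy' : 0 < 1 + b * y := by positivity
  have hne : (1 + b * y) / (1 + b * z) ≠ 1 := by
    rw [Ne, div_eq_one_iff_eq hz'.ne']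
    intro h
    exact hyz (mul_left_cancel₀ hb.ne' (by linarith))
  have h := Real.log_lt_sub_one_of_pos (div_pos hy' hz') hne
  rw [Real.log_div hy'.ne' hz'.ne'] at h
  have : b * (z - y) / (1 + b * z) = 1 - (1 + b * y) / (1 + b * z) := by
    field_simp
    ring
  linarith

/-- Pointwise comparison of the two contests at `u = p ^ m`, with the multiplier taken at the
single crossing point of the two scale-transformed quantile functions. -/
lemma crossing_mul_le (N b c d u : ℝ) (hN : 0 < N) (hb : 0 < b) (hc : 0 ≤ c) (hd : 0 < d)
    (hu : 0 ≤ u) (hcd : c * d + b * N * c < 1) :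
    b * N / (d + b * N) * (max (u - c) 0 / ((1 - c * d) / N) - N * u) ≤
      N * u * (b * (max (u - c) 0 / ((1 - c * d) / N) - N * u) /
        (1 + b * (max (u - c) 0 / ((1 - c * d) / N)))) := by
  have hbN : 0 < b * N := by positivity
  have hbNc : 0 ≤ b * N * c := by positivity
  have h1 : 0 < 1 - c * d := by linarith
  have hK : 0 < d + b * N := by linarith
  rcases le_total u c with h | h
  · rw [max_eq_right (by linarith)]
    simp only [zero_div, mul_zero, add_zero, div_one, zero_sub]
    have hle : u ≤ 1 / (d + b * N) := by
      rw [le_div_iff₀ hK]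
      nlinarith
    have : 0 ≤ b * N * (N * u) * (1 / (d + b * N) - u) :=
      mul_nonneg (by positivity) (by linarith)
    have e : b * N / (d + b * N) = b * N * (1 / (d + b * N)) := by ring
    rw [e]
    nlinarith
  · rw [max_eq_left (by linarith)]
    have h2 : 0 < 1 - c * d + b * N * (u - c) := by
      have : 0 ≤ b * N * (u - c) := mul_nonneg hbN.le (by linarith)
      linarith
    have e : N * u * (b * ((u - c) / ((1 - c * d) / N) - N * u) /
        (1 + b * ((u - c) / ((1 - c * d) / N)))) -
        b * N / (d + b * N) * ((u - c) / ((1 - c * d) / N) - N * u) =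
        b * N ^ 2 * c * (u * d - 1) ^ 2 * (1 - c * d - b * N * c) /
          ((1 - c * d) * (d + b * N) * (1 - c * d + b * N * (u - c))) := by
      have h3 : 1 + b * ((u - c) / ((1 - c * d) / N)) =
          (1 - c * d + b * N * (u - c)) / (1 - c * d) := by
        field_simp
      rw [h3]
      field_simp
      ring
    have : 0 ≤ b * N ^ 2 * c * (u * d - 1) ^ 2 * (1 - c * d - b * N * c) /
          ((1 - c * d) * (d + b * N) * (1 - c * d + b * N * (u - c))) := by
      have : 0 < 1 - c * d - b * N * c := by linarith
      positivity
    linarith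

/-- Even with negative drift, some strictly positive submission fee yields a strictly
higher expected winner's performance than no fee. -/
theorem driftF_positive_fee_beats_zero (n : ℕ) (hn : 2 ≤ n) (x₀ σ μ : ℝ)
    (hx₀ : 0 < x₀) (hσ : 0 < σ) (hμ : μ < 0) :
    ∃ c ∈ Set.Ioo (0 : ℝ) 1, driftExpMax n x₀ μ σ 0 < driftExpMax n x₀ μ σ c := by
  obtain ⟨m, rfl⟩ : ∃ m, n = m + 1 := ⟨n - 1, by omega⟩
  have hm : 1 ≤ m := by omega
  have hm1 : (1 : ℝ) ≤ m := by exact_mod_cast hm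
  have hβ : 0 < -(2 * μ) / σ ^ 2 := div_pos (by linarith) (by positivity)
  have hb : 0 < Real.exp (-(2 * μ) / σ ^ 2 * x₀) - 1 := by
    have := Real.add_one_lt_exp (mul_pos hβ hx₀).ne'
    nlinarith [mul_pos hβ hx₀]
  have key := fun a => driftExpMax_eq m hm x₀ σ μ a hx₀ hσ hμ
  set β := -(2 * μ) / σ ^ 2
  set b := Real.exp (β * x₀) - 1
  have hN : (0 : ℝ) < m + 1 := by positivity
  obtain ⟨a, ha, ha1, hab⟩ : ∃ a : ℝ, 0 < a ∧ a < 1 ∧ a * ((m + 1) * (1 + b)) < 1 := by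
    have hk : 0 < ((m : ℝ) + 1) * (1 + b) := by positivity
    refine ⟨1 / (2 * ((m + 1) * (1 + b))), by positivity, ?_, ?_⟩
    · rw [div_lt_one (by positivity)]
      nlinarith [mul_pos hN hb]
    · rw [one_div_mul_eq_div, div_lt_one (by positivity)]
      linarith
  have hc : 0 < a ^ m := by positivity
  have hca : a ^ m ≤ a := pow_le_of_le_one ha.le ha1.le (by omega)
  have hc1 : a ^ m < 1 := hca.trans_lt ha1
  have hlc := lamFee_pow m hm a ha.le
  have hl0 := lamFee_pow m hm 0 le_rfl
  obtain ⟨d, hd⟩ : ∃ d : ℝ, d = (m + 1) - m * a := ⟨_, rfl⟩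
  have hd1 : 1 < d := by
    rw [hd]
    nlinarith
  have hdN : d ≤ m + 1 := by
    rw [hd]
    nlinarith
  have hcd : a ^ m * d + b * (m + 1) * a ^ m < 1 := by
    have h1 : a ^ m * ((m + 1) * (1 + b)) ≤ a * ((m + 1) * (1 + b)) :=
      mul_le_mul_of_nonneg_right hca (by positivity)
    have h2 : a ^ m * d ≤ a ^ m * (m + 1) := mul_le_mul_of_nonneg_left hdN hc.le
    linarith
  have hbNc : 0 < b * (m + 1) * a ^ m := by positivity
  have hlpos : 0 < lamFee (m + 1) (a ^ m) := by
    rw [hlc, ← hd]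
    exact div_pos (by linarith) hN
  have hl0pos : 0 < lamFee (m + 1) (0 ^ m) := by
    rw [hl0, zero_pow (by omega)]
    simpa using hN
  have hY := integral_max_pow_sub_div m 0 _ le_rfl one_pos hl0pos.ne' hl0
  have hZ := integral_max_pow_sub_div m a _ ha.le ha1 hlpos.ne' hlc
  refine ⟨a ^ m, ⟨hc, hc1⟩, ?_⟩
  have key0 := key 0 le_rfl one_pos hl0pos
  have keya := key a ha.le ha1 hlpos
  set Y : ℝ → ℝ := fun p => max (p ^ m - 0 ^ m) 0 / lamFee (m + 1) (0 ^ m) with hYdef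
  set Z : ℝ → ℝ := fun p => max (p ^ m - a ^ m) 0 / lamFee (m + 1) (a ^ m) with hZdef
  have hY0 : ∀ p, 0 ≤ Y p := fun p => div_nonneg (le_max_right _ _) hl0pos.le
  have hZ0 : ∀ p, 0 ≤ Z p := fun p => div_nonneg (le_max_right _ _) hlpos.le
  have hYc : Continuous Y := by fun_prop
  have hZc : Continuous Z := by fun_prop
  have hYp : ∀ p, 0 ≤ p → Y p = (m + 1) * p ^ m := by
    intro p hp
    simp only [hYdef, hl0]
    rw [zero_pow (by omega), sub_zero, max_eq_left (by positivity)]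
    field_simp
    ring
  have hcont : ∀ W : ℝ → ℝ, Continuous W → (∀ p, 0 ≤ W p) →
      Continuous fun p : ℝ => (m + 1) * p ^ m * (Real.log (1 + b * W p) / β) := by
    intro W hW hW0
    refine Continuous.mul (by fun_prop) (Continuous.div_const (Continuous.log (by fun_prop) ?_) β)
    intro p
    have := hW0 p
    positivity
  have hYi := hcont Y hYc hY0
  have hZi := hcont Z hZc hZ0
  have hcross : ∀ p, 0 ≤ p →
      b * (m + 1) / (d + b * (m + 1)) * (Z p - Y p) ≤
        (m + 1) * p ^ m * (b * (Z p - Y p) / (1 + b * Z p)) := by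
    intro p hp
    have := crossing_mul_le (m + 1) b (a ^ m) d (p ^ m) hN hb hc.le (by linarith)
      (by positivity) hcd
    rw [hYp p hp]
    simpa only [hZdef, hlc, ← hd] using this
  have hstrict : ∀ p, 0 < p → Y p ≠ Z p →
      b * (m + 1) / (d + b * (m + 1)) / β * (Z p - Y p) <
        (m + 1) * p ^ m * (Real.log (1 + b * Z p) / β) -
          (m + 1) * p ^ m * (Real.log (1 + b * Y p) / β) := by
    intro p hp hne
    have h1 := mul_lt_mul_of_pos_left
      (lt_log_one_add_sub_log_one_add b (Y p) (Z p) hb (hY0 p) (hZ0 p) hne)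
      (show 0 < ((m : ℝ) + 1) * p ^ m by positivity)
    have h2 := div_lt_div_of_pos_right ((hcross p hp.le).trans_lt h1) hβ
    calc _ = b * (m + 1) / (d + b * (m + 1)) * (Z p - Y p) / β := by ring
      _ < _ := h2
      _ = _ := by ring
  have hne1 : Y 1 ≠ Z 1 := by
    rw [hYp 1 zero_le_one]
    simp only [hZdef, hlc, ← hd, one_pow, mul_one]
    rw [max_eq_left (by linarith)]
    have h1 : 0 < 1 - a ^ m * d := by linarith
    intro h
    field_simp at h
    nlinarith
  have hlt : ∫ p in (0 : ℝ)..1, b * (m + 1) / (d + b * (m + 1)) / β * (Z p - Y p) <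
      ∫ p in (0 : ℝ)..1, ((m + 1) * p ^ m * (Real.log (1 + b * Z p) / β) -
          (m + 1) * p ^ m * (Real.log (1 + b * Y p) / β)) := by
    refine intervalIntegral.integral_lt_integral_of_continuousOn_of_le_of_exists_lt one_pos
      (Continuous.continuousOn (by fun_prop)) (hZi.sub hYi).continuousOn ?_
      ⟨1, ⟨zero_le_one, le_rfl⟩, hstrict 1 one_pos hne1⟩
    intro p hp
    by_cases h : Y p = Z p
    · rw [h]
      simp
    · exact (hstrict p hp.1 h).le
  rw [intervalIntegral.integral_const_mul,
    intervalIntegral.integral_sub (hZc.intervalIntegrable _ _) (hYc.intervalIntegrable _ _),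
    intervalIntegral.integral_sub (hZi.intervalIntegrable _ _) (hYi.intervalIntegrable _ _),
    hY, hZ, sub_self, mul_zero, ← keya, ← key0, zero_pow (by omega)] at hlt
  linarith
end
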